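/- Let q ∈ (1,2] and J(u) = Σₖ |uₖ|^q on ℓ^q. Then for every u ∈ ℓ^{2(q−1)} with u ≠ 0 there exist a constant c_q = c_q(u) > 0 and a threshold t₀ > 0 such that for all v ∈ ℓ^q with ‖v − u‖_{ℓ^q} ≤ t₀, the Bregman distance satisfies D_J(v,u) ≥ c_q · ‖v − u‖_{ℓ^q}². -/

import Mathlib

noncomputable section

open scoped RealInnerProductSpace ENNReal NNReal
open Filter Topology

/-- `∑ₖ |xₖ|^q` as an extended nonnegative real. -/
def lqSum (q : ℝ) (x : ℕ → ℝ) : ℝ≥0∞ := ∑' k, ENNReal.ofReal (|x k| ^ q)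

/-- The `ℓ^q`-norm of a real sequence (`= ∞` if `x ∉ ℓ^q`). -/
def lqNorm (q : ℝ) (x : ℕ → ℝ) : ℝ≥0∞ := lqSum q x ^ (1 / q)

/-- The Bregman distance `D_J(v, u)` of `J(x) = ∑ₖ |xₖ|^q` (the subgradient of
`J` at `u ∈ ℓ^{2(q-1)}` being unique, with `k`-th coordinate
`q·sign(uₖ)·|uₖ|^{q-1}`). -/
def DJq (q : ℝ) (v u : ℕ → ℝ) : EReal :=
  ((lqSum q v : ℝ≥0∞) : EReal) - ((lqSum q u : ℝ≥0∞) : EReal)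
    - ((∑' k, q * Real.sign (u k) * |u k| ^ (q - 1) * (v k - u k) : ℝ) : EReal)

lemma lqAux_mono_pos (q M : ℝ) (hq1 : 1 < q) (hq2 : q ≤ 2) (hM : 0 < M) (s t : ℝ)
    (hs : 0 ≤ s) (hst : s ≤ t) (htM : t ≤ M) :
    (q - 1) * M ^ (q - 2) * (t - s) ≤ t ^ (q - 1) - s ^ (q - 1) := by
  rcases hst.eq_or_lt with rfl | hlt
  · simp
  have ht : 0 < t := lt_of_le_of_lt hs hlt
  have h1 : M ^ (q - 2) ≤ t ^ (q - 2) :=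
    Real.rpow_le_rpow_of_nonpos ht htM (by linarith)
  have h2 : (1 + (s / t - 1)) ^ (q - 1) ≤ 1 + (q - 1) * (s / t - 1) := by
    apply rpow_one_add_le_one_add_mul_self
    · have : 0 ≤ s / t := by positivity
      linarith
    · linarith
    · linarith
  have h3 : (1 + (s / t - 1)) = s / t := by ring
  rw [h3, Real.div_rpow hs ht.le] at h2
  have h4 : t ^ (q - 1) = t ^ (q - 2) * t := by
    rw [show q - 1 = (q - 2) + 1 by ring, Real.rpow_add_one ht.ne']
  have h5 : 0 < t ^ (q - 1) := Real.rpow_pos_of_pos ht _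
  rw [div_le_iff₀ h5] at h2
  have h6 : (1 + (q - 1) * (s / t - 1)) * t ^ (q - 1)
      = t ^ (q - 1) - (q - 1) * t ^ (q - 2) * (t - s) := by
    rw [h4]; field_simp; ring
  rw [h6] at h2
  have h7 : (q - 1) * M ^ (q - 2) * (t - s) ≤ (q - 1) * t ^ (q - 2) * (t - s) := by
    gcongr
  linarith

lemma lqAux_deriv_eq (q : ℝ) (hq1 : 1 < q) (x : ℝ) :
    q * |x| ^ (q - 2) * x = q * Real.sign x * |x| ^ (q - 1) := by
  rcases lt_trichotomy x 0 with h | h | h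
  · rw [Real.sign_of_neg h, show q - 1 = (q - 2) + 1 by ring,
      Real.rpow_add_one (abs_pos.2 h.ne).ne', abs_of_neg h]
    ring
  · simp [h]
  · rw [Real.sign_of_pos h, show q - 1 = (q - 2) + 1 by ring,
      Real.rpow_add_one (abs_pos.2 h.ne').ne', abs_of_pos h]
    ring

lemma lqAux_mono (q M : ℝ) (hq1 : 1 < q) (hq2 : q ≤ 2) (hM : 0 < M) (s t : ℝ)
    (hs : -M ≤ s) (hst : s ≤ t) (htM : t ≤ M) :
    q * Real.sign s * |s| ^ (q - 1) - q * (q - 1) * M ^ (q - 2) * s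
      ≤ q * Real.sign t * |t| ^ (q - 1) - q * (q - 1) * M ^ (q - 2) * t := by
  have hz : (0 : ℝ) ^ (q - 1) = 0 := Real.zero_rpow (by linarith)
  -- formula for nonneg and nonpos
  have fp : ∀ x : ℝ, 0 ≤ x → Real.sign x * |x| ^ (q - 1) = x ^ (q - 1) := by
    intro x hx
    rcases hx.eq_or_lt with rfl | hx
    · simp [hz]
    · rw [Real.sign_of_pos hx, abs_of_pos hx, one_mul]
  have fn : ∀ x : ℝ, x ≤ 0 → Real.sign x * |x| ^ (q - 1) = - (-x) ^ (q - 1) := by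
    intro x hx
    rcases hx.eq_or_lt with rfl | hx
    · simp [hz]
    · rw [Real.sign_of_neg hx, abs_of_neg hx]; ring
  have key : (q - 1) * M ^ (q - 2) * (t - s)
      ≤ Real.sign t * |t| ^ (q - 1) - Real.sign s * |s| ^ (q - 1) := by
    rcases le_total 0 s with h | h
    · rw [fp s h, fp t (h.trans hst)]
      exact lqAux_mono_pos q M hq1 hq2 hM s t h hst htM
    · rcases le_total 0 t with h' | h'
      · rw [fn s h, fp t h']
        have h1 := lqAux_mono_pos q M hq1 hq2 hM 0 t le_rfl h' htM
        have h2 := lqAux_mono_pos q M hq1 hq2 hM 0 (-s) le_rfl (by linarith) (by linarith)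
        rw [hz] at h1 h2
        linarith
      · rw [fn s h, fn t h']
        have h2 := lqAux_mono_pos q M hq1 hq2 hM (-t) (-s) (by linarith) (by linarith)
          (by linarith)
        linarith
  have := mul_le_mul_of_nonneg_left key (show 0 ≤ q by linarith)
  linarith

/-- scalar Bregman lower bound -/
lemma lqAux_scalar (q : ℝ) (hq1 : 1 < q) (hq2 : q ≤ 2) (x y : ℝ) :
    q * (q - 1) / 2 * ((y - x) ^ 2 * (|x| + |y - x|) ^ (q - 2))
      ≤ |y| ^ q - |x| ^ q - q * Real.sign x * |x| ^ (q - 1) * (y - x) := by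
  set M := |x| + |y - x| with hMdef
  have hM0 : 0 ≤ M := by positivity
  rcases hM0.eq_or_lt with h0 | hM
  · have hx : x = 0 := abs_eq_zero.1 (by linarith [abs_nonneg x, abs_nonneg (y - x)])
    have hy : y - x = 0 := abs_eq_zero.1 (by linarith [abs_nonneg x, abs_nonneg (y - x)])
    have hy' : y = 0 := by linarith
    simp [hx, hy']
  set κ := q * (q - 1) * M ^ (q - 2) with hκ
  let G : ℝ → ℝ := fun t => |t| ^ q - κ / 2 * t ^ 2
  let g : ℝ → ℝ := fun t => q * Real.sign t * |t| ^ (q - 1) - κ * t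
  have hG : ∀ t, HasDerivAt G (g t) t := by
    intro t
    have h1 := hasDerivAt_abs_rpow t hq1
    rw [lqAux_deriv_eq q hq1] at h1
    have h2 := ((hasDerivAt_id t).pow 2).const_mul (κ / 2)
    refine (h1.sub h2).congr_deriv ?_
    simp [g]; ring
  have hxM : |x| ≤ M := by linarith [abs_nonneg (y - x)]
  have hyM : |y| ≤ M := by
    have := abs_add_le x (y - x)
    rw [add_sub_cancel] at this
    exact this
  have hmono : ∀ s t, -M ≤ s → s ≤ t → t ≤ M → g s ≤ g t := fun s t h1 h2 h3 =>
    lqAux_mono q M hq1 hq2 hM s t h1 h2 h3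
  have hcont : Continuous G := continuous_iff_continuousAt.2 fun t => (hG t).continuousAt
  have key : g x * (y - x) ≤ G y - G x := by
    rcases lt_trichotomy x y with h | h | h
    · obtain ⟨c, hc, hc'⟩ := exists_hasDerivAt_eq_slope G g h hcont.continuousOn
        (fun t _ => hG t)
      have h1 : g x ≤ g c := hmono _ _ (by linarith [neg_abs_le x]) hc.1.le
        (by linarith [hc.2, le_abs_self y])
      have h2 : 0 < y - x := by linarith
      rw [eq_div_iff h2.ne'] at hc'
      nlinarith
    · simp [h]
    · obtain ⟨c, hc, hc'⟩ := exists_hasDerivAt_eq_slope G g h hcont.continuousOn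
        (fun t _ => hG t)
      have h1 : g c ≤ g x := hmono _ _ (by linarith [neg_abs_le y, hc.1]) hc.2.le
        (by linarith [le_abs_self x])
      have h2 : 0 < x - y := by linarith
      rw [eq_div_iff h2.ne'] at hc'
      nlinarith
  have e : q * (q - 1) / 2 * ((y - x) ^ 2 * M ^ (q - 2)) = κ / 2 * (y - x) ^ 2 := by
    rw [hκ]; ring
  rw [e]
  simp only [G, g] at key
  nlinarith

lemma lqAux_young (q : ℝ) (hq1 : 1 < q) (hq2 : q ≤ 2) (s h w : ℝ) (hs : 0 ≤ s)
    (hw : |h| ≤ w) :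
    2 / q * (s ^ (2 - q) * |h| ^ q) - (2 / q - 1) * (s ^ 2 * w ^ q)
      ≤ h ^ 2 * w ^ (q - 2) := by
  have hw0 : 0 ≤ w := (abs_nonneg h).trans hw
  have hq0 : 0 < q := by linarith
  rcases hw0.eq_or_lt with h0 | hwp
  · subst h0
    have : h = 0 := abs_eq_zero.1 (le_antisymm hw (abs_nonneg h))
    simp [this, Real.zero_rpow hq0.ne']
  have am := Real.geom_mean_le_arith_mean2_weighted (w₁ := (2 - q) / 2) (w₂ := q / 2)
    (p₁ := s ^ 2 * w ^ q) (p₂ := h ^ 2 * w ^ (q - 2)) (by linarith) (by linarith)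
    (by positivity) (by positivity) (by ring)
  have e : (s ^ 2 * w ^ q) ^ ((2 - q) / 2) * (h ^ 2 * w ^ (q - 2)) ^ (q / 2)
      = s ^ (2 - q) * |h| ^ q := by
    rw [← sq_abs h, Real.mul_rpow (by positivity) (by positivity),
      Real.mul_rpow (by positivity) (by positivity), ← Real.rpow_natCast s,
      ← Real.rpow_natCast |h|, ← Real.rpow_mul hs, ← Real.rpow_mul (abs_nonneg h),
      ← Real.rpow_mul hw0, ← Real.rpow_mul hw0]
    have e1 : ((2 : ℕ) : ℝ) * ((2 - q) / 2) = 2 - q := by push_cast; ring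
    have e2 : ((2 : ℕ) : ℝ) * (q / 2) = q := by push_cast; ring
    have e3 : w ^ (q * ((2 - q) / 2)) * w ^ ((q - 2) * (q / 2)) = 1 := by
      rw [← Real.rpow_add hwp, show q * ((2 - q) / 2) + (q - 2) * (q / 2) = 0 by ring,
        Real.rpow_zero]
    rw [e1, e2]
    linear_combination (s ^ (2 - q) * |h| ^ q) * e3
  rw [e] at am
  have := mul_le_mul_of_nonneg_left am (show 0 ≤ 2 / q by positivity)
  have e4 : 2 / q * ((2 - q) / 2 * (s ^ 2 * w ^ q) + q / 2 * (h ^ 2 * w ^ (q - 2)))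
    = (2 / q - 1) * (s ^ 2 * w ^ q) + h ^ 2 * w ^ (q - 2) := by
    field_simp
  linarith

lemma lqAux_summable (p : ℝ) (x : ℕ → ℝ) (h : lqSum p x ≠ ⊤) :
    Summable fun k => |x k| ^ p := by
  have := ENNReal.summable_toReal h
  refine this.congr fun k => ?_
  rw [ENNReal.toReal_ofReal (by positivity)]

lemma lqAux_sum_eq (p : ℝ) (x : ℕ → ℝ) (h : Summable fun k => |x k| ^ p) :
    lqSum p x = ENNReal.ofReal (∑' k, |x k| ^ p) :=
  (ENNReal.ofReal_tsum_of_nonneg (fun k => by positivity) h).symm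

lemma lqAux_add (q : ℝ) (hq : 0 < q) (a b : ℝ) (ha : 0 ≤ a) (hb : 0 ≤ b) :
    (a + b) ^ q ≤ 2 ^ q * (a ^ q + b ^ q) := by
  have h1 : (a + b) ^ q ≤ (2 * max a b) ^ q := by
    apply Real.rpow_le_rpow (by positivity) _ hq.le
    linarith [le_max_left a b, le_max_right a b]
  rw [Real.mul_rpow (by norm_num) (by positivity)] at h1
  refine h1.trans (mul_le_mul_of_nonneg_left ?_ (by positivity))
  have := Real.rpow_nonneg ha q
  have := Real.rpow_nonneg hb q
  rcases max_cases a b with h | h <;> rw [h.1] <;> linarith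

/-- Lemma 6.2: local quadratic lower bound for the Bregman distance of
`J(u) = ∑ₖ |uₖ|^q`, `1 < q ≤ 2`, in terms of the `ℓ^q`-norm. -/
theorem lq_bregman_lower_bound (q : ℝ) (hq1 : 1 < q) (hq2 : q ≤ 2)
    (u : ℕ → ℝ) (hu : lqSum (2 * (q - 1)) u ≠ ⊤) (hu0 : u ≠ 0) :
    ∃ c : ℝ, 0 < c ∧ ∃ t₀ : ℝ, 0 < t₀ ∧
      ∀ v : ℕ → ℝ, lqSum q v ≠ ⊤ → lqNorm q (v - u) ≤ ENNReal.ofReal t₀ →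
        ((ENNReal.ofReal c * lqNorm q (v - u) ^ 2 : ℝ≥0∞) : EReal) ≤ DJq q v u := by
  have hq0 : 0 < q := by linarith
  have hsu2 := lqAux_summable _ u hu
  have hsu : Summable fun k => |u k| ^ q := by
    refine Summable.of_norm_bounded_eventually_nat hsu2 ?_
    have ht := hsu2.tendsto_atTop_zero
    filter_upwards [ht.eventually (gt_mem_nhds (show (0 : ℝ) < 1 by norm_num))] with k hk
    rw [Real.norm_of_nonneg (by positivity)]
    rcases (abs_nonneg (u k)).eq_or_lt with h0 | h0
    · rw [← h0, Real.zero_rpow hq0.ne', Real.zero_rpow (by linarith)]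
    · have : |u k| ≤ 1 := by
        by_contra hc
        push Not at hc
        have := Real.one_lt_rpow hc (show 0 < 2 * (q - 1) by linarith)
        linarith
      exact Real.rpow_le_rpow_of_exponent_ge h0 this (by linarith)
  set A := ∑' k, |u k| ^ q with hA
  have hA0 : 0 ≤ A := tsum_nonneg fun k => by positivity
  set W : ℝ := 2 ^ q * (A + 1) with hW
  have hWp : 0 < W := by positivity
  have hq1' : 0 < q - 1 := by linarith
  refine ⟨q * (q - 1) / 2 * W ^ (1 - 2 / q), by positivity, 1, one_pos, ?_⟩
  intro v hv hvu
  have hsv := lqAux_summable _ v hv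
  have hsh : Summable fun k => |(v - u) k| ^ q := by
    refine Summable.of_nonneg_of_le (fun k => by positivity) (fun k => ?_)
      ((hsv.add hsu).mul_left (2 ^ q))
    refine le_trans ?_ (lqAux_add q hq0 _ _ (abs_nonneg _) (abs_nonneg _))
    exact Real.rpow_le_rpow (abs_nonneg _) (abs_sub _ _) hq0.le
  set N := ∑' k, |(v - u) k| ^ q with hN
  have hN0 : 0 ≤ N := tsum_nonneg fun k => by positivity
  have hnorm : lqNorm q (v - u) = ENNReal.ofReal (N ^ (1 / q)) := by
    rw [lqNorm, lqAux_sum_eq q _ hsh, ENNReal.ofReal_rpow_of_nonneg hN0 (by positivity)]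
  have hN1 : N ≤ 1 := by
    rw [hnorm, ENNReal.ofReal_le_ofReal_iff zero_le_one] at hvu
    by_contra hc
    push Not at hc
    have := Real.one_lt_rpow hc (show 0 < 1 / q by positivity)
    linarith
  have hwle : ∀ k, (|u k| + |v k - u k|) ^ q ≤ 2 ^ q * (|u k| ^ q + |(v - u) k| ^ q) :=
    fun k => lqAux_add q hq0 _ _ (abs_nonneg _) (abs_nonneg _)
  have hsw : Summable fun k => (|u k| + |v k - u k|) ^ q :=
    Summable.of_nonneg_of_le (fun k => by positivity) hwle ((hsu.add hsh).mul_left (2 ^ q))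
  have hwW : ∑' k, (|u k| + |v k - u k|) ^ q ≤ W := by
    refine (hsw.tsum_le_tsum hwle ((hsu.add hsh).mul_left (2 ^ q))).trans ?_
    rw [tsum_mul_left, hsu.tsum_add hsh, hW]
    gcongr
  have hsx : Summable fun k => q * Real.sign (u k) * |u k| ^ (q - 1) * (v k - u k) := by
    refine Summable.of_norm_bounded (hsw.mul_left q) fun k => ?_
    have hsg : |Real.sign (u k)| ≤ 1 := by
      rcases Real.sign_apply_eq (u k) with h | h | h <;> rw [h] <;> simp
    rw [Real.norm_eq_abs, abs_mul, abs_mul, abs_mul, abs_of_pos hq0,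
      abs_of_nonneg (Real.rpow_nonneg (abs_nonneg (u k)) _)]
    set w := |u k| + |v k - u k| with hw
    have hw0 : 0 ≤ w := by positivity
    have e : w ^ q = w ^ (q - 1) * w := by
      rw [← Real.rpow_add_one' hw0 (by linarith)]; congr 1; ring
    rw [e]
    have h1 : |u k| ^ (q - 1) ≤ w ^ (q - 1) :=
      Real.rpow_le_rpow (abs_nonneg _) (by linarith [abs_nonneg (v k - u k)]) hq1'.le
    have h2 : |v k - u k| ≤ w := by linarith [abs_nonneg (u k)]
    calc q * |Real.sign (u k)| * |u k| ^ (q - 1) * |v k - u k|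
        ≤ q * 1 * w ^ (q - 1) * w := by gcongr
      _ = _ := by ring
  set X := ∑' k, q * Real.sign (u k) * |u k| ^ (q - 1) * (v k - u k) with hX
  set V := ∑' k, |v k| ^ q with hV
  have hV0 : 0 ≤ V := tsum_nonneg fun k => by positivity
  have hD : DJq q v u = ((V - A - X : ℝ) : EReal) := by
    rw [DJq, lqAux_sum_eq q _ hsv, lqAux_sum_eq q _ hsu, EReal.coe_ennreal_ofReal,
      EReal.coe_ennreal_ofReal, max_eq_left hV0, max_eq_left hA0]
    norm_cast
  have hs : 0 ≤ (N / W) ^ (1 / q) := by positivity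
  set s := (N / W) ^ (1 / q) with hsdef
  have hsum : q * (q - 1) / 2 * (2 / q * (s ^ (2 - q) * N)
      - (2 / q - 1) * (s ^ 2 * ∑' k, (|u k| + |v k - u k|) ^ q)) ≤ V - A - X := by
    have hS1 := ((hsh.mul_left (s ^ (2 - q))).mul_left (2 / q)).sub
      ((hsw.mul_left (s ^ 2)).mul_left (2 / q - 1))
    have hS2 := (hsv.sub hsu).sub hsx
    have := (hS1.mul_left (q * (q - 1) / 2)).tsum_le_tsum (fun k => ?_) hS2
    · rw [tsum_mul_left, Summable.tsum_sub, tsum_mul_left, tsum_mul_left, tsum_mul_left,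
        tsum_mul_left, Summable.tsum_sub, Summable.tsum_sub] at this
      · exact this
      · exact hsv
      · exact hsu
      · exact hsv.sub hsu
      · exact hsx
      · exact (hsh.mul_left (s ^ (2 - q))).mul_left (2 / q)
      · exact (hsw.mul_left (s ^ 2)).mul_left (2 / q - 1)
    · refine le_trans ?_ (lqAux_scalar q hq1 hq2 (u k) (v k))
      refine mul_le_mul_of_nonneg_left ?_ (by positivity)
      exact lqAux_young q hq1 hq2 s (v k - u k) _ hs (by linarith [abs_nonneg (u k)])
  have hsq : s ^ q * W = N := by
    rw [hsdef, ← Real.rpow_mul (by positivity), one_div_mul_cancel hq0.ne', Real.rpow_one]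
    field_simp
  have hs2 : s ^ (2 - q) * s ^ q = s ^ 2 := by
    rw [← Real.rpow_add' hs (by norm_num), ← Real.rpow_natCast]
    norm_num
  have hfin : W ^ (1 - 2 / q) * (N ^ (1 / q)) ^ 2 = s ^ 2 * W := by
    rw [hsdef, Real.div_rpow hN0 hWp.le, div_pow, Real.rpow_sub hWp, Real.rpow_one,
      ← Real.rpow_natCast (W ^ (1 / q)), ← Real.rpow_mul hWp.le]
    have : 1 / q * ((2 : ℕ) : ℝ) = 2 / q := by push_cast; ring
    rw [this]; ring
  rw [hD, hnorm, ← ENNReal.ofReal_pow (by positivity), ← ENNReal.ofReal_mul (by positivity),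
    EReal.coe_ennreal_ofReal, max_eq_left (by positivity), EReal.coe_le_coe_iff]
  refine le_trans ?_ hsum
  rw [mul_assoc, hfin]
  refine mul_le_mul_of_nonneg_left ?_ (by positivity)
  have h2q : 0 ≤ 2 / q - 1 := by
    rw [sub_nonneg, le_div_iff₀ hq0]; linarith
  have h3 : (2 / q - 1) * (s ^ 2 * ∑' k, (|u k| + |v k - u k|) ^ q)
      ≤ (2 / q - 1) * (s ^ 2 * W) := by gcongr
  have h4 : s ^ (2 - q) * N = s ^ 2 * W := by
    rw [← hs2, ← hsq]; ring
  rw [h4]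
  linarith
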